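/- The polytope P_m (convex hull of a regular m-gon Q_m together with two orthogonal segments v_1v_2 and u_1u_2 parallel to Q_m on opposite sides, each crossing over the interior of Q_m, with m even) admits dissections of every size from 2m-2 to 4m-6. -/

import Mathlib

open Set MeasureTheory
open scoped Classical

noncomputable section

abbrev Pt3 := Fin 3 → ℝ

/-- A (geometric) tetrahedron: 4 affinely independent points. -/
def IsTet (σ : Finset Pt3) : Prop :=
  σ.card = 4 ∧ AffineIndependent ℝ (fun p : (σ : Set Pt3) => (p : Pt3))

/-- A dissection of the convex polytope `conv V` using only vertices in `V`:
tetrahedra with pairwise disjoint interiors covering the polytope. -/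
def IsDissection (V : Finset Pt3) (D : Finset (Finset Pt3)) : Prop :=
  (∀ σ ∈ D, IsTet σ ∧ (σ : Set Pt3) ⊆ (V : Set Pt3)) ∧
  (∀ σ ∈ D, ∀ τ ∈ D, σ ≠ τ →
    interior (convexHull ℝ (σ : Set Pt3)) ∩ interior (convexHull ℝ (τ : Set Pt3)) = ∅) ∧
  (⋃ σ ∈ D, convexHull ℝ (σ : Set Pt3)) = convexHull ℝ (V : Set Pt3)

/-- A triangulation: a dissection in which any two tetrahedra meet in a common
(possibly empty) face. -/
def IsTriangulation (V : Finset Pt3) (D : Finset (Finset Pt3)) : Prop :=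
  IsDissection V D ∧
  ∀ σ ∈ D, ∀ τ ∈ D,
    convexHull ℝ (σ : Set Pt3) ∩ convexHull ℝ (τ : Set Pt3)
      = convexHull ℝ ((σ ∩ τ : Finset Pt3) : Set Pt3)

/-- The vertex set of the standard regular `m`-gon in the plane `z = 0`. -/
def regPoly (m : ℕ) : Finset Pt3 :=
  (Finset.univ : Finset (Fin m)).image
    (fun k => ![Real.cos (2 * Real.pi * k.1 / m), Real.sin (2 * Real.pi * k.1 / m), 0])

/-- The hypotheses describing the polytope `P_m`: the convex hull of a regular
`m`-gon `Q_m` (m even) together with two orthogonal segments `v₁v₂` and `u₁u₂`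
parallel to the plane of `Q_m`, on opposite sides of it, each of the four
segments `vᵢuⱼ` crossing the relative interior of `Q_m`, and with `v₁v₂`, `u₁u₂`
not parallel to any edge or diagonal of `Q_m`. -/
def PmSetup (m : ℕ) (v₁ v₂ u₁ u₂ : Pt3) : Prop :=
  Even m ∧ 3 ≤ m ∧ v₁ ≠ v₂ ∧ u₁ ≠ u₂ ∧
  -- v₁v₂ parallel to the plane of Q_m, above it; u₁u₂ parallel, below it
  v₁ 2 = v₂ 2 ∧ 0 < v₁ 2 ∧ u₁ 2 = u₂ 2 ∧ u₁ 2 < 0 ∧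
  -- the two segments are orthogonal to each other
  ((v₂ 0 - v₁ 0) * (u₂ 0 - u₁ 0) + (v₂ 1 - v₁ 1) * (u₂ 1 - u₁ 1) = 0) ∧
  -- the four segments vᵢuⱼ intersect the relative interior of Q_m
  (∀ v ∈ ({v₁, v₂} : Set Pt3), ∀ u ∈ ({u₁, u₂} : Set Pt3),
    (openSegment ℝ v u ∩ intrinsicInterior ℝ (convexHull ℝ (regPoly m : Set Pt3))).Nonempty) ∧
  -- v₁v₂ and u₁u₂ are not parallel to any edge or diagonal of Q_m
  (∀ a ∈ regPoly m, ∀ b ∈ regPoly m, a ≠ b → ∀ t : ℝ,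
    v₂ - v₁ ≠ t • (b - a) ∧ u₂ - u₁ ≠ t • (b - a))


lemma sep_interior (l : Pt3 →ₗ[ℝ] ℝ) (c : ℝ) (hl : ∃ w, l w ≠ 0) (A B : Set Pt3)
    (hA : ∀ x ∈ A, l x ≤ c) (hB : ∀ x ∈ B, c ≤ l x) : interior A ∩ interior B = ∅ := by
  obtain ⟨w, hw⟩ := hl
  rw [← interior_inter]
  by_contra hne
  obtain ⟨x, hx⟩ := Set.nonempty_iff_ne_empty.mpr hne
  have hcont : Continuous (fun e : ℝ => x + e • w) := by fun_prop
  have hmem : interior (A ∩ B) ∈ nhds (x + (0:ℝ) • w) := by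
    simpa using isOpen_interior.mem_nhds hx
  have hev := hcont.continuousAt.preimage_mem_nhds hmem
  obtain ⟨ε, hε, hball⟩ := Metric.mem_nhds_iff.mp hev
  have h1 : (ε/2) ∈ Metric.ball (0:ℝ) ε := by
    simp [abs_of_pos hε]; linarith
  have h2 := interior_subset (hball h1)
  have h3 := interior_subset hx
  have e1 : l (x + (ε/2) • w) = c := le_antisymm (hA _ h2.1) (hB _ h2.2)
  have e2 : l x = c := le_antisymm (hA _ h3.1) (hB _ h3.2)
  rw [map_add, map_smul, e2, smul_eq_mul] at e1
  have : (ε/2) * l w ≠ 0 := mul_ne_zero (by positivity) hw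
  exact this (by linarith)

lemma conv_le (l : Pt3 →ₗ[ℝ] ℝ) (c : ℝ) (T : Set Pt3) (h : ∀ x ∈ T, l x ≤ c) :
    ∀ x ∈ convexHull ℝ T, l x ≤ c := by
  intro x hx
  exact convexHull_min (t := {x | l x ≤ c}) h (convex_halfSpace_le l.isLinear c) hx

lemma conv_ge (l : Pt3 →ₗ[ℝ] ℝ) (c : ℝ) (T : Set Pt3) (h : ∀ x ∈ T, c ≤ l x) :
    ∀ x ∈ convexHull ℝ T, c ≤ l x := by
  intro x hx
  exact convexHull_min (t := {x | c ≤ l x}) h (convex_halfSpace_ge l.isLinear c) hx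

lemma exists_functional {e1 e2 e3 : Pt3} (li : LinearIndependent ℝ ![e1, e2, e3]) (r1 r2 r3 : ℝ) :
    ∃ l : Pt3 →ₗ[ℝ] ℝ, l e1 = r1 ∧ l e2 = r2 ∧ l e3 = r3 := by
  let B := basisOfLinearIndependentOfCardEqFinrank li (by simp)
  have hB : ∀ i, B i = ![e1, e2, e3] i := fun i => by simp [B]
  refine ⟨B.constr ℝ ![r1, r2, r3], ?_, ?_, ?_⟩
  · have := B.constr_basis ℝ ![r1, r2, r3] 0
    rw [hB] at this; simpa using this
  · have := B.constr_basis ℝ ![r1, r2, r3] 1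
    rw [hB] at this; simpa using this
  · have := B.constr_basis ℝ ![r1, r2, r3] 2
    rw [hB] at this; simpa using this

lemma li_of_det {e1 e2 e3 : Pt3}
    (h : e1 0 * (e2 1 * e3 2 - e2 2 * e3 1) - e1 1 * (e2 0 * e3 2 - e2 2 * e3 0)
      + e1 2 * (e2 0 * e3 1 - e2 1 * e3 0) ≠ 0) : LinearIndependent ℝ ![e1, e2, e3] := by
  have : LinearIndependent ℝ (Matrix.of ![e1, e2, e3]).row := by
    rw [Matrix.linearIndependent_rows_iff_isUnit, Matrix.isUnit_iff_isUnit_det, isUnit_iff_ne_zero,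
      Matrix.det_fin_three]
    simp
    intro h'
    apply h
    linarith
  exact this

lemma isTet_of_li {p a b c : Pt3} (li : LinearIndependent ℝ ![a - p, b - p, c - p]) :
    IsTet {p, a, b, c} := by
  have hai : AffineIndependent ℝ ![p, a, b, c] := by
    rw [affineIndependent_iff_linearIndependent_vsub ℝ _ (0 : Fin 4)]
    rw [← linearIndependent_equiv (finSuccAboveEquiv (0 : Fin 4))]
    have heq : ((fun i : {x : Fin 4 // x ≠ 0} => ![p, a, b, c] i -ᵥ ![p, a, b, c] 0) ∘
        (finSuccAboveEquiv (0 : Fin 4))) = ![a - p, b - p, c - p] := by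
      ext i j
      fin_cases i <;> simp [finSuccAboveEquiv]
    rw [heq]
    exact li
  have hinj := hai.injective
  have hr : Set.range ![p, a, b, c] = (({p, a, b, c} : Finset Pt3) : Set Pt3) := by
    ext x
    simp [Matrix.range_cons, Matrix.range_empty]
    tauto
  constructor
  · have : ({p, a, b, c} : Finset Pt3) = Finset.univ.image ![p, a, b, c] := by
      apply Finset.coe_injective
      rw [← hr]; simp
    rw [this, Finset.card_image_of_injective _ hinj]; simp
  · have := hai.range
    rw [hr] at this
    exact this

lemma mem_conv4 {T : Set Pt3} {p a b c : Pt3} (hp : p ∈ T) (ha : a ∈ T) (hb : b ∈ T) (hc : c ∈ T)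
    {w x y z : ℝ} (hw : 0 ≤ w) (hx : 0 ≤ x) (hy : 0 ≤ y) (hz : 0 ≤ z) (hs : w + x + y + z = 1) :
    w • p + x • a + y • b + z • c ∈ convexHull ℝ T := by
  have hconv := convex_convexHull ℝ T
  have := hconv.sum_mem (t := Finset.univ) (w := ![w, x, y, z]) (z := ![p, a, b, c])
    (by intro i _; fin_cases i <;> simp [*]) (by simp [Fin.sum_univ_four, hs])
    (by intro i _; fin_cases i <;> simp <;> apply subset_convexHull ℝ T <;> assumption)
  simpa [Fin.sum_univ_four] using this

/-- Segment from `p` to `y` crosses the triangle `abc`. -/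
lemma cover_seg {T : Set Pt3} {p a b c y x : Pt3} (ha : a ∈ T) (hb : b ∈ T) (hc : c ∈ T)
    (hy : y ∈ convexHull ℝ T) {α β γ : ℝ} (hα : 0 ≤ α) (hβ : 0 ≤ β) (hγ : 0 ≤ γ)
    (hs : 1 ≤ α + β + γ) (hyp : y - p = α • (a - p) + β • (b - p) + γ • (c - p))
    (hx : x ∈ segment ℝ p y) :
    x ∈ convexHull ℝ (({p, a, b, c} : Finset Pt3) : Set Pt3) ∨ x ∈ convexHull ℝ T := by
  obtain ⟨u, t, hu, ht, hut, rfl⟩ := hx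
  have hyy : y = p + (α • (a - p) + β • (b - p) + γ • (c - p)) := by rw [← hyp]; abel
  rcases le_total (t * (α + β + γ)) 1 with h | h
  · left
    have := mem_conv4 (T := (({p, a, b, c} : Finset Pt3) : Set Pt3)) (p := p) (a := a) (b := b)
      (c := c) (by simp) (by simp) (by simp) (by simp) (w := 1 - t * (α + β + γ)) (x := t * α)
      (y := t * β) (z := t * γ) (by linarith) (by positivity) (by positivity) (by positivity)
      (by ring)
    convert this using 1
    rw [hyy]
    have : u = 1 - t := by linarith
    subst this
    module
  · right
    have hσ : 0 < α + β + γ := by linarith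
    set σ := α + β + γ with hσd
    have hz := mem_conv4 (T := T) ha hb hc hc (w := α / σ) (x := β / σ) (y := γ / σ) (z := 0)
      (by positivity) (by positivity) (by positivity) le_rfl (by field_simp; rw [hσd]; ring)
    set z := (α / σ) • a + (β / σ) • b + (γ / σ) • c + (0:ℝ) • c with hzd
    -- x = u p + t y ; y = (1-σ) p + σ z
    have hyz : y = (1 - σ) • p + σ • z := by
      rw [hyy, hzd]
      simp only [smul_add, smul_smul, mul_div_cancel₀ _ hσ.ne']
      rw [hσd]
      module
    clear_value z
    rcases eq_or_lt_of_le hs with h1 | h1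
    · have : t = 1 := by nlinarith
      have hu0 : u = 0 := by linarith
      rw [this, hu0]; simpa using hy
    · -- p = (y - σ z)/(1-σ)
      have hp : u • p + t • y = (u * σ / (σ - 1)) • z + (t - u / (σ - 1)) • y := by
        have h2 : σ - 1 ≠ 0 := by linarith
        have : p = (σ / (σ - 1)) • z - (1 / (σ - 1)) • y := by
          rw [hyz]
          have e1 : (1 / (σ - 1)) * (1 - σ) = -1 := by field_simp; ring
          have e2 : (1 / (σ - 1)) * σ = σ / (σ - 1) := by ring
          rw [smul_add, smul_smul, smul_smul, e1, e2]
          module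
        conv_lhs => rw [this]
        rw [smul_sub, smul_smul, smul_smul]
        have e1 : u * (σ / (σ - 1)) = u * σ / (σ - 1) := by ring
        have e2 : u * (1 / (σ - 1)) = u / (σ - 1) := by ring
        rw [e1, e2]
        module
      rw [hp]
      have h3 : 0 < σ - 1 := by linarith
      apply convex_convexHull ℝ T hz hy
      · positivity
      · rw [sub_nonneg, div_le_iff₀ h3]; nlinarith
      · field_simp; nlinarith

/-- Gluing a new tetrahedron below an existing family. -/
lemma sep_tet_of_li {T : Set Pt3} {p a b c : Pt3} {l : Pt3 →ₗ[ℝ] ℝ}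
    (h1 : l (a - p) = 1) (h2 : l (b - p) = 1) (h3 : l (c - p) = 1)
    (hT : ∀ t ∈ T, 1 ≤ l (t - p)) (σ : Set Pt3) (hσ : σ ⊆ T) :
    interior (convexHull ℝ (({p, a, b, c} : Finset Pt3) : Set Pt3)) ∩
      interior (convexHull ℝ σ) = ∅ := by
  rw [map_sub] at h1 h2 h3
  apply sep_interior l (l p + 1) ⟨a - p, by rw [map_sub, h1]; norm_num⟩
  · apply conv_le
    intro x hx
    simp only [Finset.coe_insert, Finset.coe_singleton, Set.mem_insert_iff,
      Set.mem_singleton_iff] at hx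
    rcases hx with rfl | rfl | rfl | rfl <;> linarith
  · apply conv_ge
    intro x hx
    have := hT x (hσ hx)
    rw [map_sub] at this
    linarith

lemma step1 {T : Finset Pt3} {p a b c : Pt3} {D : Finset (Finset Pt3)} (hD : IsDissection T D)
    (hp : p ∉ T) (ha : a ∈ T) (hb : b ∈ T) (hc : c ∈ T)
    (li : LinearIndependent ℝ ![a - p, b - p, c - p])
    (hcone : ∀ t ∈ T, ∃ α β γ : ℝ, 0 ≤ α ∧ 0 ≤ β ∧ 0 ≤ γ ∧ 1 ≤ α + β + γ ∧
      t - p = α • (a - p) + β • (b - p) + γ • (c - p)) :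
    IsDissection (insert p T) (insert {p, a, b, c} D) ∧
      (insert {p, a, b, c} D : Finset (Finset Pt3)).card = D.card + 1 := by
  obtain ⟨hD1, hD2, hD3⟩ := hD
  obtain ⟨l, l1, l2, l3⟩ := exists_functional li 1 1 1
  have hlT : ∀ t ∈ (T : Set Pt3), 1 ≤ l (t - p) := by
    intro t ht
    obtain ⟨α, β, γ, h1, h2, h3, h4, h5⟩ := hcone t ht
    rw [h5]; simp only [map_add, map_smul, l1, l2, l3, smul_eq_mul]; linarith
  have hsep := sep_tet_of_li l1 l2 l3 hlT
  have hsub : (({p, a, b, c} : Finset Pt3) : Set Pt3) ⊆ ((insert p T : Finset Pt3) : Set Pt3) := by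
    intro x hx
    simp at hx ⊢
    rcases hx with rfl | rfl | rfl | rfl <;> simp [*]
  have hsub2 : (T : Set Pt3) ⊆ ((insert p T : Finset Pt3) : Set Pt3) := by simp
  refine ⟨⟨?_, ?_, ?_⟩, ?_⟩
  · intro σ hσ
    rcases Finset.mem_insert.mp hσ with rfl | hσ
    · exact ⟨isTet_of_li li, hsub⟩
    · exact ⟨(hD1 σ hσ).1, (hD1 σ hσ).2.trans hsub2⟩
  · intro σ hσ τ hτ hne
    rcases Finset.mem_insert.mp hσ with rfl | hσ <;> rcases Finset.mem_insert.mp hτ with rfl | hτ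
    · exact absurd rfl hne
    · exact hsep _ (hD1 τ hτ).2
    · rw [Set.inter_comm]; exact hsep _ (hD1 σ hσ).2
    · exact hD2 σ hσ τ hτ hne
  · rw [Finset.set_biUnion_insert, hD3]
    apply Set.Subset.antisymm
    · exact Set.union_subset (convexHull_mono hsub) (convexHull_mono hsub2)
    · intro x hx
      rw [Finset.coe_insert, convexHull_insert ⟨a, ha⟩] at hx
      simp only [convexJoin_singleton_left, Set.mem_iUnion] at hx
      obtain ⟨y, hy, hx⟩ := hx
      have hyc : ∃ α β γ : ℝ, 0 ≤ α ∧ 0 ≤ β ∧ 0 ≤ γ ∧ 1 ≤ α + β + γ ∧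
          y - p = α • (a - p) + β • (b - p) + γ • (c - p) := by
        refine convexHull_min (t := {y : Pt3 | ∃ α β γ : ℝ, 0 ≤ α ∧ 0 ≤ β ∧ 0 ≤ γ ∧
          1 ≤ α + β + γ ∧ y - p = α • (a - p) + β • (b - p) + γ • (c - p)}) hcone ?_ hy
        rintro y ⟨α, β, γ, h1, h2, h3, h4, h5⟩ y' ⟨α', β', γ', h1', h2', h3', h4', h5'⟩ u t hu ht hut
        refine ⟨u * α + t * α', u * β + t * β', u * γ + t * γ', by positivity, by positivity,
          by positivity, by nlinarith, ?_⟩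
        have : u • y + t • y' - p = u • (y - p) + t • (y' - p) := by
          have : u = 1 - t := by linarith
          subst this; module
        rw [this, h5, h5']; module
      obtain ⟨α, β, γ, h1, h2, h3, h4, h5⟩ := hyc
      exact cover_seg (T := (T : Set Pt3)) ha hb hc hy h1 h2 h3 h4 h5 hx
  · rw [Finset.card_insert_of_notMem]
    intro hmem
    exact hp ((hD1 _ hmem).2 (by simp))

lemma step2 {T : Finset Pt3} {p a b c e : Pt3} {D : Finset (Finset Pt3)} (hD : IsDissection T D)
    (hp : p ∉ T) (ha : a ∈ T) (hb : b ∈ T) (hc : c ∈ T) (he : e ∈ T)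
    (hne : e ∉ ({p, a, b, c} : Finset Pt3))
    (li1 : LinearIndependent ℝ ![a - p, b - p, c - p])
    (li2 : LinearIndependent ℝ ![a - p, c - p, e - p])
    {lam mu : ℝ} (hmu : 0 < mu) (hlam : mu ≤ lam)
    (hrel : e - c = lam • (a - p) - mu • (b - p))
    (hcone : ∀ t ∈ T, t ≠ c → t ≠ e → ∃ α β : ℝ, 0 ≤ α ∧ 0 ≤ β ∧ 1 ≤ α + β ∧
      t - p = α • (a - p) + β • (b - p)) :
    IsDissection (insert p T) (insert {p, a, c, e} (insert {p, a, b, c} D)) ∧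
      (insert {p, a, c, e} (insert {p, a, b, c} D) : Finset (Finset Pt3)).card = D.card + 2 := by
  obtain ⟨hD1, hD2, hD3⟩ := hD
  obtain ⟨l, l1, l2, l3⟩ := exists_functional li1 1 1 1
  obtain ⟨k, k1, k2, k3⟩ := exists_functional li2 1 1 1
  obtain ⟨j, j1, j2, j3⟩ := exists_functional li2 0 0 1
  have he1 : e - p = (c - p) + lam • (a - p) - mu • (b - p) := by
    have : e - p = (c - p) + (e - c) := by abel
    rw [this, hrel]; abel
  have le1 : 1 ≤ l (e - p) := by
    rw [he1]; simp only [map_add, map_sub (f := l) (_ + _), map_smul, l1, l2, l3, smul_eq_mul]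
    linarith
  have kb : 1 ≤ k (b - p) := by
    have := congrArg k he1
    simp only [map_add, map_sub (f := k) (_ + _), map_smul, k1, k2, k3, smul_eq_mul] at this
    nlinarith
  have jb : j (b - p) ≤ 0 := by
    have := congrArg j he1
    simp only [map_add, map_sub (f := j) (_ + _), map_smul, j1, j2, j3, smul_eq_mul] at this
    nlinarith
  have hlT : ∀ t ∈ (T : Set Pt3), 1 ≤ l (t - p) := by
    intro t ht
    by_cases htc : t = c
    · rw [htc, l3]
    by_cases hte : t = e
    · rw [hte]; exact le1
    obtain ⟨α, β, h1, h2, h4, h5⟩ := hcone t ht htc hte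
    rw [h5]; simp only [map_add, map_smul, l1, l2, smul_eq_mul]; linarith
  have hkT : ∀ t ∈ (T : Set Pt3), 1 ≤ k (t - p) := by
    intro t ht
    by_cases htc : t = c
    · rw [htc, k2]
    by_cases hte : t = e
    · rw [hte, k3]
    obtain ⟨α, β, h1, h2, h4, h5⟩ := hcone t ht htc hte
    rw [h5]; simp only [map_add, map_smul, k1, smul_eq_mul]; nlinarith
  have hsep1 := sep_tet_of_li l1 l2 l3 hlT
  have hsep2 := sep_tet_of_li k1 k2 k3 hkT
  have hsep3 : interior (convexHull ℝ (({p, a, b, c} : Finset Pt3) : Set Pt3)) ∩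
      interior (convexHull ℝ (({p, a, c, e} : Finset Pt3) : Set Pt3)) = ∅ := by
    apply sep_interior j (j p) ⟨e - p, by rw [j3]; norm_num⟩
    · rw [map_sub] at jb j1 j2 j3
      apply conv_le
      intro x hx
      simp only [Finset.coe_insert, Finset.coe_singleton, Set.mem_insert_iff,
        Set.mem_singleton_iff] at hx
      rcases hx with rfl | rfl | rfl | rfl <;> linarith
    · rw [map_sub] at jb j1 j2 j3
      apply conv_ge
      intro x hx
      simp only [Finset.coe_insert, Finset.coe_singleton, Set.mem_insert_iff,
        Set.mem_singleton_iff] at hx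
      rcases hx with rfl | rfl | rfl | rfl <;> linarith
  have hsub : (({p, a, b, c} : Finset Pt3) : Set Pt3) ⊆ ((insert p T : Finset Pt3) : Set Pt3) := by
    intro x hx
    simp at hx ⊢
    rcases hx with rfl | rfl | rfl | rfl <;> simp [*]
  have hsub' : (({p, a, c, e} : Finset Pt3) : Set Pt3) ⊆ ((insert p T : Finset Pt3) : Set Pt3) := by
    intro x hx
    simp at hx ⊢
    rcases hx with rfl | rfl | rfl | rfl <;> simp [*]
  have hsub2 : (T : Set Pt3) ⊆ ((insert p T : Finset Pt3) : Set Pt3) := by simp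
  refine ⟨⟨?_, ?_, ?_⟩, ?_⟩
  · intro σ hσ
    rcases Finset.mem_insert.mp hσ with rfl | hσ
    · exact ⟨isTet_of_li li2, hsub'⟩
    rcases Finset.mem_insert.mp hσ with rfl | hσ
    · exact ⟨isTet_of_li li1, hsub⟩
    · exact ⟨(hD1 σ hσ).1, (hD1 σ hσ).2.trans hsub2⟩
  · intro σ hσ τ hτ hne
    simp only [Finset.mem_insert (s := insert _ D), Finset.mem_insert (s := D)] at hσ hτ
    rcases hσ with rfl | rfl | hσ <;> rcases hτ with rfl | rfl | hτ
    · exact absurd rfl hne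
    · rw [Set.inter_comm]; exact hsep3
    · exact hsep2 _ (hD1 τ hτ).2
    · exact hsep3
    · exact absurd rfl hne
    · exact hsep1 _ (hD1 τ hτ).2
    · rw [Set.inter_comm]; exact hsep2 _ (hD1 σ hσ).2
    · rw [Set.inter_comm]; exact hsep1 _ (hD1 σ hσ).2
    · exact hD2 σ hσ τ hτ hne
  · rw [Finset.set_biUnion_insert, Finset.set_biUnion_insert, hD3]
    apply Set.Subset.antisymm
    · exact Set.union_subset (convexHull_mono hsub')
        (Set.union_subset (convexHull_mono hsub) (convexHull_mono hsub2))
    · intro x hx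
      rw [Finset.coe_insert, convexHull_insert ⟨a, ha⟩] at hx
      simp only [convexJoin_singleton_left, Set.mem_iUnion] at hx
      obtain ⟨y, hy, hx⟩ := hx
      have hyc : ∃ α β γ δ : ℝ, 0 ≤ α ∧ 0 ≤ β ∧ 0 ≤ γ ∧ 0 ≤ δ ∧
          y - p = α • (a - p) + β • (b - p) + γ • (c - p) + δ • (e - p) := by
        refine convexHull_min (t := {y : Pt3 | ∃ α β γ δ : ℝ, 0 ≤ α ∧ 0 ≤ β ∧ 0 ≤ γ ∧ 0 ≤ δ ∧
          y - p = α • (a - p) + β • (b - p) + γ • (c - p) + δ • (e - p)}) ?_ ?_ hy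
        · intro t ht
          by_cases htc : t = c
          · exact ⟨0, 0, 1, 0, by simp, by simp, by simp, by simp, by rw [htc]; module⟩
          by_cases hte : t = e
          · exact ⟨0, 0, 0, 1, by simp, by simp, by simp, by simp, by rw [hte]; module⟩
          obtain ⟨α, β, h1, h2, h4, h5⟩ := hcone t ht htc hte
          exact ⟨α, β, 0, 0, h1, h2, le_rfl, le_rfl, by rw [h5]; module⟩
        · rintro y ⟨α, β, γ, δ, h1, h2, h3, h4, h5⟩ y' ⟨α', β', γ', δ', h1', h2', h3', h4', h5'⟩
            u t hu ht hut
          refine ⟨u * α + t * α', u * β + t * β', u * γ + t * γ', u * δ + t * δ', by positivity,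
            by positivity, by positivity, by positivity, ?_⟩
          have : u • y + t • y' - p = u • (y - p) + t • (y' - p) := by
            have : u = 1 - t := by linarith
            subst this; module
          rw [this, h5, h5']; module
      obtain ⟨α, β, γ, δ, h1, h2, h3, h4, h5⟩ := hyc
      have hly : 1 ≤ l (y - p) := by
        have := conv_ge l (l p + 1) (T : Set Pt3)
          (fun t ht => by have := hlT t ht; rw [map_sub] at this; linarith) y hy
        rw [map_sub]; linarith
      have hky : 1 ≤ k (y - p) := by
        have := conv_ge k (k p + 1) (T : Set Pt3)
          (fun t ht => by have := hkT t ht; rw [map_sub] at this; linarith) y hy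
        rw [map_sub]; linarith
      rcases le_total β (mu * δ) with hb' | hb'
      · have hy2 : y - p = (α + β / mu * lam) • (a - p) + (γ + β / mu) • (c - p)
            + (δ - β / mu) • (e - p) := by
          have hbm : β • (b - p) = (β / mu) • (mu • (b - p)) := by
            rw [smul_smul, div_mul_cancel₀ _ hmu.ne']
          have hbb : mu • (b - p) = (c - p) + lam • (a - p) - (e - p) := by rw [he1]; abel
          rw [h5, hbm, hbb]; module
        have hd : 0 ≤ δ - β / mu := by
          rw [sub_nonneg, div_le_iff₀ hmu]; linarith
        have hsum : 1 ≤ (α + β / mu * lam) + (γ + β / mu) + (δ - β / mu) := by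
          rw [hy2] at hky
          simp only [map_add, map_smul, k1, k2, k3, smul_eq_mul] at hky
          linarith
        have hl0 : 0 ≤ lam := by linarith
        rcases cover_seg (T := (T : Set Pt3)) ha hc he hy (by positivity) (by positivity) hd hsum
          hy2 hx with h | h
        · exact Or.inl h
        · exact Or.inr (Or.inr h)
      · have hy2 : y - p = (α + δ * lam) • (a - p) + (β - mu * δ) • (b - p)
            + (γ + δ) • (c - p) := by
          rw [h5, he1]; module
        have hsum : 1 ≤ (α + δ * lam) + (β - mu * δ) + (γ + δ) := by
          rw [hy2] at hly
          simp only [map_add, map_smul, l1, l2, l3, smul_eq_mul] at hly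
          linarith
        have hl0 : 0 ≤ lam := by linarith
        rcases cover_seg (T := (T : Set Pt3)) ha hb hc hy (by positivity) (by linarith)
          (by positivity) hsum hy2 hx with h | h
        · exact Or.inr (Or.inl h)
        · exact Or.inr (Or.inr h)
  · rw [Finset.card_insert_of_notMem, Finset.card_insert_of_notMem]
    · intro hmem
      exact hp ((hD1 _ hmem).2 (by simp))
    · intro hmem
      rcases Finset.mem_insert.mp hmem with h | h
      · exact hne (h ▸ (by simp))
      · exact hp ((hD1 _ h).2 (by simp))

lemma circle_param (p : Pt3) (hp : p 0 ^ 2 + p 1 ^ 2 = 1) (s : Pt3)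
    (hs : s 0 ^ 2 + s 1 ^ 2 = 1) (hne : ¬ (s 0 = p 0 ∧ s 1 = p 1)) :
    ∃ τ : ℝ, s 0 - p 0 = 2 / (1 + τ ^ 2) * (- p 0 - τ * p 1) ∧
      s 1 - p 1 = 2 / (1 + τ ^ 2) * (- p 1 + τ * p 0) := by
  set ρ := 1 - (p 0 * s 0 + p 1 * s 1) with hρ
  have hρ2 : 2 * ρ = (s 0 - p 0) ^ 2 + (s 1 - p 1) ^ 2 := by rw [hρ]; nlinarith
  have hρ0 : 0 < ρ := by
    by_contra hcon
    push Not at hcon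
    apply hne
    constructor <;> nlinarith [sq_nonneg (s 0 - p 0), sq_nonneg (s 1 - p 1)]
  set κ := p 0 * s 1 - p 1 * s 0 with hκ
  have hk : κ ^ 2 = 2 * ρ - ρ ^ 2 := by
    have : κ ^ 2 + (p 0 * s 0 + p 1 * s 1) ^ 2 =
      (p 0 ^ 2 + p 1 ^ 2) * (s 0 ^ 2 + s 1 ^ 2) := by rw [hκ]; ring
    rw [hp, hs] at this
    have h2 : p 0 * s 0 + p 1 * s 1 = 1 - ρ := by rw [hρ]; ring
    rw [h2] at this
    linarith
  have h2 : 2 / (1 + (κ / ρ) ^ 2) = ρ := by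
    have : 1 + (κ / ρ) ^ 2 = 2 / ρ := by
      rw [div_pow, hk]; field_simp; ring
    rw [this]; field_simp
  refine ⟨κ / ρ, ?_, ?_⟩
  · rw [h2]
    have : ρ * (- p 0 - κ / ρ * p 1) = - ρ * p 0 - κ * p 1 := by field_simp
    rw [this, hρ, hκ]
    linear_combination -(s 0) * hp
  · rw [h2]
    have : ρ * (- p 1 + κ / ρ * p 0) = - ρ * p 1 + κ * p 0 := by field_simp
    rw [this, hρ, hκ]
    linear_combination -(s 1) * hp

lemma ear (S : Finset Pt3) (hS : ∀ s ∈ S, s 2 = 0 ∧ s 0 ^ 2 + s 1 ^ 2 = 1) (hcard : 3 ≤ S.card)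
    (p : Pt3) (hp : p ∈ S) :
    ∃ a ∈ S, ∃ b ∈ S, a ≠ p ∧ b ≠ p ∧
      (a 0 - p 0) * (b 1 - p 1) - (a 1 - p 1) * (b 0 - p 0) ≠ 0 ∧
      ∀ s ∈ S, s ≠ p → ∃ α β : ℝ, 0 ≤ α ∧ 0 ≤ β ∧ 1 ≤ α + β ∧
        s - p = α • (a - p) + β • (b - p) := by
  obtain ⟨hp2, hp1⟩ := hS p hp
  have hpar : ∀ s : Pt3, ∃ τ : ℝ, s ∈ S → s ≠ p →
      s 0 - p 0 = 2 / (1 + τ ^ 2) * (- p 0 - τ * p 1) ∧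
      s 1 - p 1 = 2 / (1 + τ ^ 2) * (- p 1 + τ * p 0) := by
    intro s
    by_cases h : s ∈ S ∧ s ≠ p
    · obtain ⟨τ, hτ⟩ := circle_param p hp1 s (hS s h.1).2 (by
        rintro ⟨h0, h1⟩
        apply h.2
        ext i
        fin_cases i
        · exact h0
        · exact h1
        · simp [(hS s h.1).1, hp2])
      exact ⟨τ, fun _ _ => hτ⟩
    · exact ⟨0, fun h1 h2 => absurd ⟨h1, h2⟩ h⟩
  choose τ hτ using hpar
  have hc' : 1 < (S.erase p).card := by rw [Finset.card_erase_of_mem hp]; omega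
  have hne : (S.erase p).Nonempty := Finset.card_pos.mp (by omega)
  obtain ⟨a, ha, hamin⟩ := Finset.exists_min_image (S.erase p) τ hne
  obtain ⟨b, hb, hbmax⟩ := Finset.exists_max_image (S.erase p) τ hne
  have haS := Finset.mem_of_mem_erase ha
  have hbS := Finset.mem_of_mem_erase hb
  have hap := Finset.ne_of_mem_erase ha
  have hbp := Finset.ne_of_mem_erase hb
  have hinj : ∀ s ∈ S.erase p, ∀ t ∈ S.erase p, τ s = τ t → s = t := by
    intro s hs t ht hst
    have h1 := hτ s (Finset.mem_of_mem_erase hs) (Finset.ne_of_mem_erase hs)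
    have h2 := hτ t (Finset.mem_of_mem_erase ht) (Finset.ne_of_mem_erase ht)
    rw [hst, ← h2.1, ← h2.2] at h1
    ext i
    fin_cases i
    · simpa using h1.1
    · simpa using h1.2
    · simp [(hS s (Finset.mem_of_mem_erase hs)).1, (hS t (Finset.mem_of_mem_erase ht)).1]
  have hab : τ a < τ b := by
    obtain ⟨s, hs, t, ht, hst⟩ := Finset.one_lt_card.mp hc'
    rcases lt_or_eq_of_le (hamin b hb) with h | h
    · exact h
    · exfalso
      apply hst
      apply hinj s hs t ht
      have := hamin s hs; have := hamin t ht; have := hbmax s hs; have := hbmax t ht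
      linarith
  obtain ⟨a0, a1⟩ := hτ a haS hap
  obtain ⟨b0, b1⟩ := hτ b hbS hbp
  refine ⟨a, haS, b, hbS, hap, hbp, ?_, ?_⟩
  · rw [a0, a1, b0, b1]
    have : (2 / (1 + τ a ^ 2) * (- p 0 - τ a * p 1)) * (2 / (1 + τ b ^ 2) * (- p 1 + τ b * p 0)) -
      (2 / (1 + τ a ^ 2) * (- p 1 + τ a * p 0)) * (2 / (1 + τ b ^ 2) * (- p 0 - τ b * p 1)) =
      (2 / (1 + τ a ^ 2)) * (2 / (1 + τ b ^ 2)) * ((τ a - τ b) * (p 0 ^ 2 + p 1 ^ 2)) := by ring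
    rw [this, hp1]
    apply mul_ne_zero (by positivity)
    rw [mul_one]; exact sub_ne_zero.mpr hab.ne
  · intro s hs hsp
    obtain ⟨s0, s1⟩ := hτ s hs hsp
    have h1 := hamin s (Finset.mem_erase.mpr ⟨hsp, hs⟩)
    have h2 := hbmax s (Finset.mem_erase.mpr ⟨hsp, hs⟩)
    have hd : 0 < τ b - τ a := by linarith
    have e1 : 0 ≤ τ b - τ s := by linarith
    have e2 : 0 ≤ τ s - τ a := by linarith
    have pa : 0 < 1 + τ a ^ 2 := by positivity
    have pb : 0 < 1 + τ b ^ 2 := by positivity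
    have ps : 0 < 1 + τ s ^ 2 := by positivity
    refine ⟨(τ b - τ s) * (1 + τ a ^ 2) / ((τ b - τ a) * (1 + τ s ^ 2)),
      (τ s - τ a) * (1 + τ b ^ 2) / ((τ b - τ a) * (1 + τ s ^ 2)), by positivity, by positivity,
      ?_, ?_⟩
    · rw [← add_div, le_div_iff₀ (by positivity)]
      nlinarith [mul_nonneg (mul_nonneg e1 e2) hd.le]
    · ext i
      fin_cases i
      · simp only [Fin.zero_eta, Pi.sub_apply, Pi.add_apply, Pi.smul_apply, smul_eq_mul]
        rw [s0, a0, b0]; field_simp; ring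
      · simp only [Fin.mk_one, Pi.sub_apply, Pi.add_apply, Pi.smul_apply, smul_eq_mul]
        rw [s1, a1, b1]; field_simp; ring
      · simp [(hS s hs).1, (hS a haS).1, (hS b hbS).1, hp2]

lemma decomp (d a b p : Pt3) (hd : d 2 = 0) (ha : a 2 = 0) (hb : b 2 = 0) (hp : p 2 = 0)
    (hcr : (a 0 - p 0) * (b 1 - p 1) - (a 1 - p 1) * (b 0 - p 0) ≠ 0) :
    ∃ α β : ℝ, d = α • (a - p) + β • (b - p) := by
  refine ⟨(d 0 * (b 1 - p 1) - d 1 * (b 0 - p 0)) /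
    ((a 0 - p 0) * (b 1 - p 1) - (a 1 - p 1) * (b 0 - p 0)),
    ((a 0 - p 0) * d 1 - (a 1 - p 1) * d 0) /
    ((a 0 - p 0) * (b 1 - p 1) - (a 1 - p 1) * (b 0 - p 0)), ?_⟩
  ext i
  fin_cases i
  · simp only [Fin.zero_eta, Pi.sub_apply, Pi.add_apply, Pi.smul_apply, smul_eq_mul]
    rw [div_mul_eq_mul_div, div_mul_eq_mul_div, ← add_div, eq_div_iff hcr]; ring
  · simp only [Fin.mk_one, Pi.sub_apply, Pi.add_apply, Pi.smul_apply, smul_eq_mul]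
    rw [div_mul_eq_mul_div, div_mul_eq_mul_div, ← add_div, eq_div_iff hcr]; ring
  · simp [hd, ha, hb, hp]

def HasDiss (S : Finset Pt3) (v₁ v₂ : Pt3) (k : ℕ) : Prop :=
  ∃ D, IsDissection (S ∪ {v₁, v₂}) D ∧ D.card = k ∧ ∀ σ ∈ D, v₁ ∈ σ ∨ v₂ ∈ σ

lemma HasDiss.swap {S : Finset Pt3} {v₁ v₂ : Pt3} {k : ℕ} (h : HasDiss S v₁ v₂ k) :
    HasDiss S v₂ v₁ k := by
  obtain ⟨D, h1, h2, h3⟩ := h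
  exact ⟨D, by rw [Finset.pair_comm]; exact h1, h2, fun σ hσ => (h3 σ hσ).symm⟩

lemma mid_step {S : Finset Pt3} {v₁ v₂ p a b : Pt3} {k : ℕ} (hS : ∀ s ∈ S, s 2 = 0)
    (hp2 : p 2 = 0) (hz : v₁ 2 = v₂ 2) (hz0 : v₁ 2 ≠ 0)
    (hp : p ∉ S) (ha : a ∈ S) (hb : b ∈ S)
    (hcr : (a 0 - p 0) * (b 1 - p 1) - (a 1 - p 1) * (b 0 - p 0) ≠ 0)
    (hcone : ∀ s ∈ S, ∃ α β : ℝ, 0 ≤ α ∧ 0 ≤ β ∧ 1 ≤ α + β ∧ s - p = α • (a - p) + β • (b - p))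
    {α β : ℝ} (hα : 0 ≤ α) (hβ : 0 ≤ β) (hd : v₂ - v₁ = α • (a - p) + β • (b - p))
    (h : HasDiss S v₁ v₂ k) : HasDiss (insert p S) v₁ v₂ (k + 1) := by
  obtain ⟨D, h1, h2, h3⟩ := h
  have hpv1 : p ≠ v₁ := by rintro rfl; exact hz0 hp2
  have hpv2 : p ≠ v₂ := by rintro rfl; exact hz0 (hz.trans hp2)
  have li : LinearIndependent ℝ ![a - p, b - p, v₁ - p] := by
    apply li_of_det
    simp only [Pi.sub_apply, hS a ha, hS b hb, hp2]
    intro h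
    apply mul_ne_zero hcr hz0
    linear_combination h
  obtain ⟨s1, s2⟩ := step1 (a := a) (b := b) (c := v₁) (p := p) h1 (by simp [hp, hpv1, hpv2])
    (by simp [ha]) (by simp [hb]) (by simp) li (by
      intro t ht
      simp only [Finset.mem_union, Finset.mem_insert, Finset.mem_singleton] at ht
      rcases ht with ht | rfl | rfl
      · obtain ⟨x, y, hx, hy, hxy, e⟩ := hcone t ht
        exact ⟨x, y, 0, hx, hy, le_rfl, by linarith, by rw [e]; module⟩
      · exact ⟨0, 0, 1, by simp, by simp, by simp, by simp, by module⟩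
      · refine ⟨α, β, 1, hα, hβ, by simp, by linarith, ?_⟩
        rw [← hd]; module)
  refine ⟨_, by rw [Finset.insert_union]; exact s1, by rw [s2, h2], ?_⟩
  intro σ hσ
  rcases Finset.mem_insert.mp hσ with rfl | hσ
  · simp
  · exact h3 σ hσ

lemma top_step {S : Finset Pt3} {v₁ v₂ p a b : Pt3} {k : ℕ} (hS : ∀ s ∈ S, s 2 = 0)
    (hp2 : p 2 = 0) (hz : v₁ 2 = v₂ 2) (hz0 : v₁ 2 ≠ 0) (hv : v₁ ≠ v₂)
    (hp : p ∉ S) (ha : a ∈ S) (hb : b ∈ S)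
    (hcr : (a 0 - p 0) * (b 1 - p 1) - (a 1 - p 1) * (b 0 - p 0) ≠ 0)
    (hcone : ∀ s ∈ S, ∃ α β : ℝ, 0 ≤ α ∧ 0 ≤ β ∧ 1 ≤ α + β ∧ s - p = α • (a - p) + β • (b - p))
    {α β : ℝ} (hβ : 0 < β) (hα : β ≤ α) (hd : v₂ - v₁ = α • (a - p) - β • (b - p))
    (h : HasDiss S v₁ v₂ k) : HasDiss (insert p S) v₁ v₂ (k + 2) := by
  obtain ⟨D, h1, h2, h3⟩ := h
  have hn1 : ∀ s : Pt3, s 2 = 0 → s ≠ v₁ := by rintro s hs rfl; exact hz0 hs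
  have hn2 : ∀ s : Pt3, s 2 = 0 → s ≠ v₂ := by rintro s hs rfl; exact hz0 (hz.trans hs)
  have li : LinearIndependent ℝ ![a - p, b - p, v₁ - p] := by
    apply li_of_det
    simp only [Pi.sub_apply, hS a ha, hS b hb, hp2]
    intro h
    apply mul_ne_zero hcr hz0
    linear_combination h
  have li2 : LinearIndependent ℝ ![a - p, v₁ - p, v₂ - p] := by
    apply li_of_det
    have d0 := congrFun hd 0
    have d1 := congrFun hd 1
    simp only [Pi.sub_apply, Pi.smul_apply, smul_eq_mul] at d0 d1
    have e0 : v₂ 0 = v₁ 0 + (α * (a 0 - p 0) - β * (b 0 - p 0)) := by linarith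
    have e1 : v₂ 1 = v₁ 1 + (α * (a 1 - p 1) - β * (b 1 - p 1)) := by linarith
    simp only [Pi.sub_apply, hS a ha, hp2, ← hz, e0, e1]
    intro h
    apply mul_ne_zero hβ.ne' (mul_ne_zero hcr hz0)
    linear_combination h
  obtain ⟨s1, s2⟩ := step2 (a := a) (b := b) (c := v₁) (e := v₂) (p := p) h1
    (by simp [hp, hn1 p hp2, hn2 p hp2])
    (by simp [ha]) (by simp [hb]) (by simp) (by simp)
    (by simp [(hn2 p hp2).symm, (hn2 a (hS a ha)).symm, (hn2 b (hS b hb)).symm, hv.symm])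
    li li2 hβ hα hd (by
      intro t ht h1 h2
      simp only [Finset.mem_union, Finset.mem_insert, Finset.mem_singleton] at ht
      rcases ht with ht | ht | ht
      · exact hcone t ht
      · exact absurd ht h1
      · exact absurd ht h2)
  refine ⟨_, by rw [Finset.insert_union]; exact s1, by rw [s2, h2], ?_⟩
  intro σ hσ
  rcases Finset.mem_insert.mp hσ with rfl | hσ
  · simp
  rcases Finset.mem_insert.mp hσ with rfl | hσ
  · simp
  · exact h3 σ hσ

lemma half_aux (v₁ v₂ : Pt3) (hz : v₁ 2 = v₂ 2) (hz0 : v₁ 2 ≠ 0) (hv : v₁ ≠ v₂)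
    (f : Pt3 →ₗ[ℝ] ℝ)
    (hf : ∀ x, f x = (v₂ 0 - v₁ 0) * x 1 - (v₂ 1 - v₁ 1) * x 0) :
    ∀ n : ℕ, ∀ S : Finset Pt3, S.card = n + 2 →
      (∀ s ∈ S, s 2 = 0 ∧ s 0 ^ 2 + s 1 ^ 2 = 1) →
      (∀ a ∈ S, ∀ b ∈ S, a ≠ b → f a ≠ f b) →
      ∀ k, n + 1 ≤ k → k ≤ 2 * n + 1 → HasDiss S v₁ v₂ k := by
  have hfd : f (v₂ - v₁) = 0 := by rw [hf]; simp; ring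
  intro n
  induction n with
  | zero =>
    intro S hcard hS hinj k hk1 hk2
    obtain rfl : k = 1 := by omega
    obtain ⟨a, b, hab, rfl⟩ := Finset.card_eq_two.mp hcard
    have hT : ({a, b} : Finset Pt3) ∪ {v₁, v₂} = {a, b, v₁, v₂} := by
      ext; simp; tauto
    refine ⟨{{a, b, v₁, v₂}}, ?_, by simp, by simp⟩
    rw [hT]
    refine ⟨?_, ?_, by simp⟩
    · intro σ hσ
      rw [Finset.mem_singleton] at hσ
      subst hσ
      refine ⟨isTet_of_li (li_of_det ?_), subset_rfl⟩
      have h1 := hinj a (by simp) b (by simp) hab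
      rw [hf, hf] at h1
      have ha := (hS a (by simp)).1
      have hb := (hS b (by simp)).1
      simp only [Pi.sub_apply, ha, hb, ← hz]
      intro h
      apply mul_ne_zero hz0 (sub_ne_zero.mpr h1)
      linear_combination -h
    · intro σ hσ τ hτ hne
      rw [Finset.mem_singleton] at hσ hτ
      exact absurd (hσ.trans hτ.symm) hne
  | succ n ih =>
    intro S hcard hS hinj k hk1 hk2
    -- data attached to a removed vertex
    have key : ∀ p ∈ S, ∀ k', n + 1 ≤ k' → k' ≤ 2 * n + 1 →
        insert p (S.erase p) = S ∧ p ∉ S.erase p ∧ HasDiss (S.erase p) v₁ v₂ k' := by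
      intro p hp k' h1 h2
      refine ⟨Finset.insert_erase hp, by simp, ?_⟩
      apply ih _ _ _ _ _ h1 h2
      · rw [Finset.card_erase_of_mem hp]; omega
      · intro s hs; exact hS s (Finset.mem_of_mem_erase hs)
      · intro a ha b hb
        exact hinj a (Finset.mem_of_mem_erase ha) b (Finset.mem_of_mem_erase hb)
    have hSne : S.Nonempty := Finset.card_pos.mp (by omega)
    obtain ⟨M, hM, hMmax⟩ := Finset.exists_max_image S f hSne
    obtain ⟨N, hN, hNmin⟩ := Finset.exists_min_image S f hSne
    have hd2 : (v₂ - v₁) 2 = 0 := by simp [hz]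
    by_cases hk : n + 3 ≤ k
    · obtain ⟨e1, e2, e3⟩ := key M hM (k - 2) (by omega) (by omega)
      obtain ⟨a, ha, b, hb, hap, hbp, hcr, hcone⟩ := ear S hS (by omega) M hM
      have goal : ∀ a ∈ S, ∀ b ∈ S, a ≠ M → b ≠ M → f b < f a →
          (a 0 - M 0) * (b 1 - M 1) - (a 1 - M 1) * (b 0 - M 0) ≠ 0 →
          (∀ s ∈ S, s ≠ M → ∃ α β : ℝ, 0 ≤ α ∧ 0 ≤ β ∧ 1 ≤ α + β ∧
            s - M = α • (a - M) + β • (b - M)) → HasDiss S v₁ v₂ k := by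
        clear ha hb hap hbp hcr hcone a b
        intro a ha b hb hap hbp hfab hcr hcone
        obtain ⟨α, β, hd⟩ := decomp (v₂ - v₁) a b M hd2 (hS a ha).1 (hS b hb).1 (hS M hM).1 hcr
        have hfa : f a < f M := lt_of_le_of_ne (hMmax a ha) (hinj a ha M hM hap)
        have hlin := congrArg f hd
        rw [hfd] at hlin
        simp only [map_add, map_sub, map_smul, smul_eq_mul] at hlin
        have hcone' : ∀ s ∈ S.erase M, ∃ α β : ℝ, 0 ≤ α ∧ 0 ≤ β ∧ 1 ≤ α + β ∧
            s - M = α • (a - M) + β • (b - M) := fun s hs =>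
          hcone s (Finset.mem_of_mem_erase hs) (Finset.ne_of_mem_erase hs)
        have hS' : ∀ s ∈ S.erase M, s 2 = 0 := fun s hs => (hS s (Finset.mem_of_mem_erase hs)).1
        have hk2 : k - 2 + 2 = k := by omega
        have p1 : 0 < f M - f a := by linarith
        have p2 : 0 < f a - f b := by linarith
        rcases lt_trichotomy β 0 with hβ | hβ | hβ
        · have hα : 0 ≤ α := by
            by_contra hcon; push Not at hcon
            nlinarith [mul_pos_of_neg_of_neg hcon (neg_lt_zero.mpr p1),
              mul_pos_of_neg_of_neg hβ (neg_lt_zero.mpr p1),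
              mul_pos_of_neg_of_neg hβ (neg_lt_zero.mpr p2)]
          have hle : -β ≤ α := by
            by_contra hcon; push Not at hcon
            nlinarith [mul_pos (sub_pos.mpr hcon) p1, mul_pos (neg_pos.mpr hβ) p2]
          have := top_step (β := -β) hS' (hS M hM).1 hz hz0 hv e2 (Finset.mem_erase.mpr ⟨hap, ha⟩)
            (Finset.mem_erase.mpr ⟨hbp, hb⟩) hcr hcone' (by linarith) hle
            (by rw [hd]; module) e3
          rwa [e1, hk2] at this
        · exfalso
          subst hβ
          have : α = 0 := by
            have h0 : α * (f M - f a) = 0 := by linarith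
            rcases mul_eq_zero.mp h0 with h | h
            · exact h
            · exact absurd h p1.ne'
          subst this
          apply hv
          simp at hd
          exact (sub_eq_zero.mp hd).symm
        · have hle : β ≤ -α := by
            by_contra hcon; push Not at hcon
            nlinarith [mul_pos (sub_pos.mpr hcon) p1, mul_pos hβ p2]
          have := top_step (v₁ := v₂) (v₂ := v₁) (α := -α) hS' (hS M hM).1 hz.symm (hz ▸ hz0)
            hv.symm e2 (Finset.mem_erase.mpr ⟨hap, ha⟩)
            (Finset.mem_erase.mpr ⟨hbp, hb⟩) hcr hcone' hβ hle
            (by rw [← neg_sub, hd]; module) e3.swap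
          rw [e1, hk2] at this
          exact this.swap
      have hab : a ≠ b := by
        rintro rfl
        apply hcr; ring
      rcases lt_or_gt_of_ne (hinj a ha b hb hab) with h | h
      · refine goal b hb a ha hbp hap h ?_ ?_
        · intro h; apply hcr; linarith
        · intro s hs hsp
          obtain ⟨x, y, hx, hy, hxy, e⟩ := hcone s hs hsp
          exact ⟨y, x, hy, hx, by linarith, by rw [e]; abel⟩
      · exact goal a ha b hb hap hbp h hcr hcone
    · obtain ⟨p, hpS, hpM, hpN⟩ : ∃ p ∈ S, p ≠ M ∧ p ≠ N := by
        by_contra hcon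
        push Not at hcon
        have : S ⊆ {M, N} := by
          intro x hx
          by_cases h : x = M
          · simp [h]
          · simp [hcon x hx h]
        have := Finset.card_le_card this
        have := Finset.card_le_two (a := M) (b := N)
        omega
      obtain ⟨e1, e2, e3⟩ := key p hpS (k - 1) (by omega) (by omega)
      obtain ⟨a, ha, b, hb, hap, hbp, hcr, hcone⟩ := ear S hS (by omega) p hpS
      have hk2 : k - 1 + 1 = k := by omega
      have hMp : f p < f M := lt_of_le_of_ne (hMmax p hpS) (hinj p hpS M hM hpM)
      have hNp : f N < f p := lt_of_le_of_ne (hNmin p hpS) (hinj N hN p hpS hpN.symm)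
      have hcone' : ∀ s ∈ S.erase p, ∃ α β : ℝ, 0 ≤ α ∧ 0 ≤ β ∧ 1 ≤ α + β ∧
          s - p = α • (a - p) + β • (b - p) := fun s hs =>
        hcone s (Finset.mem_of_mem_erase hs) (Finset.ne_of_mem_erase hs)
      have hS' : ∀ s ∈ S.erase p, s 2 = 0 := fun s hs => (hS s (Finset.mem_of_mem_erase hs)).1
      obtain ⟨α, β, hd⟩ := decomp (v₂ - v₁) a b p hd2 (hS a ha).1 (hS b hb).1 (hS p hpS).1 hcr
      have hlin := congrArg f hd
      rw [hfd] at hlin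
      simp only [map_add, map_sub, map_smul, smul_eq_mul] at hlin
      obtain ⟨x, y, hx, hy, -, hM'⟩ := hcone M hM hpM.symm
      obtain ⟨x', y', hx', hy', -, hN'⟩ := hcone N hN hpN.symm
      have hM'' := congrArg f hM'
      have hN'' := congrArg f hN'
      simp only [map_add, map_sub, map_smul, smul_eq_mul] at hM'' hN''
      have hsign : (f a - f p) * (f b - f p) < 0 := by
        rcases lt_or_gt_of_ne (hinj a ha p hpS hap) with h1 | h1 <;>
          rcases lt_or_gt_of_ne (hinj b hb p hpS hbp) with h2 | h2
        · nlinarith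
        · exact mul_neg_of_neg_of_pos (by linarith) (by linarith)
        · exact mul_neg_of_pos_of_neg (by linarith) (by linarith)
        · nlinarith
      have hαβ : 0 ≤ α * β := by
        by_contra hcon
        push Not at hcon
        have h1 : α * (f a - f p) = -(β * (f b - f p)) := by linarith
        have h2 : α * β * ((f a - f p) * (f b - f p)) = -(β * (f b - f p)) ^ 2 := by
          linear_combination (β * (f b - f p)) * h1
        nlinarith [mul_pos_of_neg_of_neg hcon hsign, sq_nonneg (β * (f b - f p))]
      rcases mul_nonneg_iff.mp hαβ with ⟨hα, hβ⟩ | ⟨hα, hβ⟩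
      · have := mid_step hS' (hS p hpS).1 hz hz0 e2 (Finset.mem_erase.mpr ⟨hap, ha⟩)
          (Finset.mem_erase.mpr ⟨hbp, hb⟩) hcr hcone' hα hβ hd e3
        rwa [e1, hk2] at this
      · have := mid_step (v₁ := v₂) (v₂ := v₁) (α := -α) (β := -β) hS' (hS p hpS).1 hz.symm
          (hz ▸ hz0) e2 (Finset.mem_erase.mpr ⟨hap, ha⟩)
          (Finset.mem_erase.mpr ⟨hbp, hb⟩) hcr hcone' (by linarith) (by linarith)
          (by rw [← neg_sub, hd]; module) e3.swap
        rw [e1, hk2] at this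
        exact this.swap

lemma regPoly_circle {m : ℕ} : ∀ s ∈ regPoly m, s 2 = 0 ∧ s 0 ^ 2 + s 1 ^ 2 = 1 := by
  intro s hs
  unfold regPoly at hs
  obtain ⟨k, -, rfl⟩ := Finset.mem_image.mp hs
  simp

lemma regPoly_card {m : ℕ} : (regPoly m).card = m := by
  unfold regPoly
  rw [Finset.card_image_of_injective]
  · simp
  · intro i j hij
    have h0 := congrFun hij 0
    have h1 := congrFun hij 1
    simp at h0 h1
    have hm : (0:ℝ) < m := by
      have := i.pos
      exact_mod_cast this
    have h := Real.Angle.cos_sin_inj h0 h1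
    rw [Real.Angle.angle_eq_iff_two_pi_dvd_sub] at h
    obtain ⟨k, hk⟩ := h
    have hpi := Real.pi_pos
    have hk2 : (i.1 : ℝ) - j.1 = k * m := by
      field_simp at hk
      nlinarith
    have hk3 : (i.1 : ℤ) - j.1 = k * m := by exact_mod_cast hk2
    have hi := i.2
    have hj := j.2
    have hk0 : k = 0 := by
      by_contra hne
      rcases lt_or_gt_of_ne hne with h | h
      · have : k * (m:ℤ) ≤ -1 * m := by apply mul_le_mul_of_nonneg_right <;> omega
        omega
      · have : 1 * (m:ℤ) ≤ k * m := by apply mul_le_mul_of_nonneg_right <;> omega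
        omega
    subst hk0
    ext
    omega

lemma half (m : ℕ) (hm : 3 ≤ m) (v₁ v₂ : Pt3) (hz : v₁ 2 = v₂ 2) (hz0 : v₁ 2 ≠ 0) (hv : v₁ ≠ v₂)
    (hpar : ∀ a ∈ regPoly m, ∀ b ∈ regPoly m, a ≠ b → ∀ t : ℝ, v₂ - v₁ ≠ t • (b - a))
    (k : ℕ) (hk1 : m - 1 ≤ k) (hk2 : k ≤ 2 * m - 3) : HasDiss (regPoly m) v₁ v₂ k := by
  refine half_aux v₁ v₂ hz hz0 hv ((v₂ 0 - v₁ 0) • LinearMap.proj 1 -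
    (v₂ 1 - v₁ 1) • LinearMap.proj 0) (by intro x; simp) (m - 2) (regPoly m)
    (by rw [regPoly_card]; omega) regPoly_circle ?_ k (by omega) (by omega)
  intro a ha b hb hab h
  simp at h
  have ha2 := (regPoly_circle a ha).1
  have hb2 := (regPoly_circle b hb).1
  by_cases h0 : b 0 - a 0 = 0
  · have h1 : b 1 - a 1 ≠ 0 := by
      intro h1
      apply hab
      ext i
      fin_cases i
      · simp; linarith
      · simp; linarith
      · simp [ha2, hb2]
    apply hpar a ha b hb hab ((v₂ 1 - v₁ 1) / (b 1 - a 1))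
    ext i
    fin_cases i
    · simp [h0]
      have : (v₂ 0 - v₁ 0) * (b 1 - a 1) = 0 := by
        linear_combination (v₂ 1 - v₁ 1) * h0 - h
      rcases mul_eq_zero.mp this with h' | h'
      · exact h'
      · exact absurd h' h1
    · simp; field_simp
    · simp [ha2, hb2, hz]
  · apply hpar a ha b hb hab ((v₂ 0 - v₁ 0) / (b 0 - a 0))
    ext i
    fin_cases i
    · simp; field_simp
    · simp only [Fin.mk_one, Pi.sub_apply, Pi.smul_apply, smul_eq_mul]
      rw [div_mul_eq_mul_div, eq_div_iff h0]
      linear_combination h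
    · simp [ha2, hb2, hz]

lemma push {C : Set Pt3} (hC : Convex ℝ C) {v q w u : Pt3} (hv : v ∈ C) (hq : q ∈ C) (hw : w ∈ C)
    {G H : ℝ} (hG : 0 < G) (hH : 0 < H) (hwe : (G + H) • w = G • v + H • u) {α β γ : ℝ}
    (hβ : 0 ≤ β) (hγ : 0 ≤ γ) (hsum : α + β + γ = 1)
    (hle : γ * G ≤ α * H) : α • v + β • q + γ • u ∈ C := by
  have := mem_conv4 (T := C) hv hq hw hw (w := α - γ * G / H) (x := β) (y := γ * (G + H) / H)
    (z := 0) (by rw [sub_nonneg, div_le_iff₀ hH]; exact hle) hβ (by positivity) le_rfl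
    (by field_simp; nlinarith)
  rw [hC.convexHull_eq] at this
  convert this using 1
  have h1 : (γ * (G + H) / H) • w = (γ / H) • ((G + H) • w) := by rw [smul_smul]; congr 1; ring
  rw [h1, hwe, smul_add, smul_smul, smul_smul, div_mul_cancel₀ _ hH.ne']
  have h2 : γ / H * G = γ * G / H := by ring
  rw [h2]
  module

lemma cross_pt {m : ℕ} {v u : Pt3}
    (h : (openSegment ℝ v u ∩
      intrinsicInterior ℝ (convexHull ℝ (regPoly m : Set Pt3))).Nonempty)
    (hv : 0 < v 2) (hu : u 2 < 0) :
    ((-u 2) / (v 2 - u 2)) • v + (v 2 / (v 2 - u 2)) • u ∈ convexHull ℝ (regPoly m : Set Pt3) := by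
  obtain ⟨w, ⟨s, t, hs, ht, hst, rfl⟩, hw⟩ := h
  have hw := intrinsicInterior_subset hw
  have h1 := conv_le (LinearMap.proj 2) 0 _
    (fun x hx => by simpa using (regPoly_circle x hx).1.le) _ hw
  have h2 := conv_ge (LinearMap.proj 2) 0 _
    (fun x hx => by simpa using (regPoly_circle x hx).1.ge) _ hw
  simp at h1 h2
  have h3 : s * v 2 + t * u 2 = 0 := le_antisymm h1 h2
  have hs' : (-u 2) / (v 2 - u 2) = s := by
    rw [div_eq_iff (by linarith)]
    have : t = 1 - s := by linarith
    subst this; linarith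
  have ht' : v 2 / (v 2 - u 2) = t := by
    rw [div_eq_iff (by linarith)]
    have : s = 1 - t := by linarith
    subst this; linarith
  rw [hs', ht']; exact hw

lemma conv_split {m : ℕ} {v₁ v₂ u₁ u₂ : Pt3} (hm : 3 ≤ m) (hv : v₁ 2 = v₂ 2) (hv0 : 0 < v₁ 2)
    (hu : u₁ 2 = u₂ 2) (hu0 : u₁ 2 < 0)
    (h : ∀ v ∈ ({v₁, v₂} : Set Pt3), ∀ u ∈ ({u₁, u₂} : Set Pt3),
    (openSegment ℝ v u ∩ intrinsicInterior ℝ (convexHull ℝ (regPoly m : Set Pt3))).Nonempty) :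
    convexHull ℝ ((regPoly m ∪ {v₁, v₂, u₁, u₂} : Finset Pt3) : Set Pt3) ⊆
      convexHull ℝ ((regPoly m ∪ {v₁, v₂} : Finset Pt3) : Set Pt3) ∪
      convexHull ℝ ((regPoly m ∪ {u₁, u₂} : Finset Pt3) : Set Pt3) := by
  have hRne : ((regPoly m : Finset Pt3) : Set Pt3).Nonempty := by
    rw [Finset.coe_nonempty, ← Finset.card_pos, regPoly_card]; omega
  have hset : ((regPoly m ∪ {v₁, v₂, u₁, u₂} : Finset Pt3) : Set Pt3) =
      {v₁, v₂} ∪ ((regPoly m : Set Pt3) ∪ {u₁, u₂}) := by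
    ext x; simp; tauto
  intro x hx
  rw [hset, convexHull_union (by simp) (by simp), convexHull_union hRne (by simp),
    convexHull_pair, convexHull_pair] at hx
  simp only [mem_convexJoin] at hx
  obtain ⟨v, hv', y, ⟨q, hq, u, hu', hy⟩, hx⟩ := hx
  have hvA : v ∈ convexHull ℝ ((regPoly m ∪ {v₁, v₂} : Finset Pt3) : Set Pt3) := by
    rw [← convexHull_pair] at hv'
    exact convexHull_mono (by intro z; simp; tauto) hv'
  have huB : u ∈ convexHull ℝ ((regPoly m ∪ {u₁, u₂} : Finset Pt3) : Set Pt3) := by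
    rw [← convexHull_pair] at hu'
    exact convexHull_mono (by intro z; simp; tauto) hu'
  have hsA : convexHull ℝ ((regPoly m : Finset Pt3) : Set Pt3) ⊆
    convexHull ℝ ((regPoly m ∪ {v₁, v₂} : Finset Pt3) : Set Pt3) := convexHull_mono (by intro z; simp; tauto)
  have hsB : convexHull ℝ ((regPoly m : Finset Pt3) : Set Pt3) ⊆
    convexHull ℝ ((regPoly m ∪ {u₁, u₂} : Finset Pt3) : Set Pt3) := convexHull_mono (by intro z; simp; tauto)
  set H := v₁ 2 with hH
  set G := -u₁ 2 with hG
  have hG0 : 0 < G := by linarith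
  have hGH : H - u₁ 2 = G + H := by rw [hG]; ring
  have w11 := cross_pt (h v₁ (by simp) u₁ (by simp)) hv0 hu0
  have w12 := cross_pt (h v₁ (by simp) u₂ (by simp)) hv0 (hu ▸ hu0)
  have w21 := cross_pt (h v₂ (by simp) u₁ (by simp)) (hv ▸ hv0) hu0
  have w22 := cross_pt (h v₂ (by simp) u₂ (by simp)) (hv ▸ hv0) (hu ▸ hu0)
  rw [← hu] at w12 w22
  rw [← hv] at w21 w22
  rw [← hH, ← hG, hGH] at w11 w12
  rw [← hG, hGH] at w21 w22
  obtain ⟨s1, s2, hs1, hs2, hs, rfl⟩ := hv'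
  obtain ⟨t1, t2, ht1, ht2, ht, rfl⟩ := hu'
  set v := s1 • v₁ + s2 • v₂ with hvd
  set u := t1 • u₁ + t2 • u₂ with hud
  have hw : (G / (G + H)) • v + (H / (G + H)) • u ∈ convexHull ℝ (regPoly m : Set Pt3) := by
    have := mem_conv4 w11 w12 w21 w22 (w := s1 * t1) (x := s1 * t2) (y := s2 * t1) (z := s2 * t2)
      (by positivity) (by positivity) (by positivity) (by positivity)
      (by linear_combination (s1 + s2) * ht + hs)
    rw [(convex_convexHull ℝ _).convexHull_eq] at this
    convert this using 1
    rw [hvd, hud]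
    have e1 : s1 = 1 - s2 := by linarith
    have e2 : t1 = 1 - t2 := by linarith
    subst e1 e2
    module
  have hwe : (G + H) • ((G / (G + H)) • v + (H / (G + H)) • u) = G • v + H • u := by
    have : G + H ≠ 0 := by positivity
    rw [smul_add, smul_smul, smul_smul, mul_div_cancel₀ _ this, mul_div_cancel₀ _ this]
  obtain ⟨a, b, ha, hb, hab, rfl⟩ := hx
  obtain ⟨c, e, hc, he, hce, rfl⟩ := hy
  have hsum : a + b * c + b * e = 1 := by rw [add_assoc, ← mul_add, hce]; linarith
  rcases le_total (b * e * G) (a * H) with hle | hle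
  · left
    have := push (convex_convexHull ℝ _) hvA (hsA hq) (hsA hw) hG0 hv0 hwe (α := a) (β := b * c)
      (γ := b * e) (by positivity) (by positivity) hsum hle
    convert this using 1
    module
  · right
    have := push (convex_convexHull ℝ _) huB (hsB hq) (hsB hw) hv0 hG0 (u := v)
      (by rw [add_comm, hwe, add_comm]) (α := b * e) (β := b * c)
      (γ := a) (by positivity) ha (by linarith) hle
    convert this using 1
    module

/-- The polytope `P_m` admits dissections of every size from
`2m - 2` to `4m - 6`. -/
theorem Pm_dissections_all_sizes (m : ℕ) (v₁ v₂ u₁ u₂ : Pt3)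
    (h : PmSetup m v₁ v₂ u₁ u₂) :
    ∀ k : ℕ, 2 * m - 2 ≤ k → k ≤ 4 * m - 6 →
      ∃ D, IsDissection (regPoly m ∪ {v₁, v₂, u₁, u₂}) D ∧ D.card = k := by
  intro k hk1 hk2
  obtain ⟨-, hm, hv, hu, hvz, hv0, huz, hu0, -, hcross, hpar⟩ := h
  obtain ⟨k1, k2, rfl, a1, a2, b1, b2⟩ : ∃ k1 k2, k = k1 + k2 ∧ m - 1 ≤ k1 ∧ k1 ≤ 2 * m - 3 ∧
      m - 1 ≤ k2 ∧ k2 ≤ 2 * m - 3 := by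
    by_cases hk : k ≤ (m - 1) + (2 * m - 3)
    · exact ⟨m - 1, k - (m - 1), by omega, by omega, by omega, by omega, by omega⟩
    · exact ⟨2 * m - 3, k - (2 * m - 3), by omega, by omega, by omega, by omega, by omega⟩
  obtain ⟨D1, ⟨x1, x2, x3⟩, hc1, x4⟩ := half m hm v₁ v₂ hvz hv0.ne' hv
    (fun a ha b hb hab t => (hpar a ha b hb hab t).1) k1 a1 a2
  obtain ⟨D2, ⟨y1, y2, y3⟩, hc2, y4⟩ := half m hm u₁ u₂ huz hu0.ne hu
    (fun a ha b hb hab t => (hpar a ha b hb hab t).2) k2 b1 b2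
  have hz1 : ∀ σ ∈ D1, ∀ x ∈ (σ : Set Pt3), 0 ≤ x 2 := by
    intro σ hσ x hx
    have := (x1 σ hσ).2 hx
    simp at this
    rcases this with rfl | rfl | h
    · exact hv0.le
    · rw [← hvz]; exact hv0.le
    · exact (regPoly_circle x h).1.ge
  have hz2 : ∀ σ ∈ D2, ∀ x ∈ (σ : Set Pt3), x 2 ≤ 0 := by
    intro σ hσ x hx
    have := (y1 σ hσ).2 hx
    simp at this
    rcases this with rfl | rfl | h
    · exact hu0.le
    · rw [← huz]; exact hu0.le
    · exact (regPoly_circle x h).1.le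
  have hsep : ∀ σ ∈ D2, ∀ τ ∈ D1, interior (convexHull ℝ (σ : Set Pt3)) ∩
      interior (convexHull ℝ (τ : Set Pt3)) = ∅ := by
    intro σ hσ τ hτ
    apply sep_interior (LinearMap.proj 2) 0 ⟨fun _ => 1, by simp⟩
    · exact conv_le _ _ _ (hz2 σ hσ)
    · exact conv_ge _ _ _ (hz1 τ hτ)
  have hdisj : Disjoint D1 D2 := by
    rw [Finset.disjoint_left]
    intro σ h1 h2
    rcases x4 σ h1 with h | h
    · have := hz2 σ h2 _ h
      linarith
    · have := hz2 σ h2 _ h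
      linarith
  have hsA : ((regPoly m ∪ {v₁, v₂} : Finset Pt3) : Set Pt3) ⊆
      ((regPoly m ∪ {v₁, v₂, u₁, u₂} : Finset Pt3) : Set Pt3) := by intro z; simp; tauto
  have hsB : ((regPoly m ∪ {u₁, u₂} : Finset Pt3) : Set Pt3) ⊆
      ((regPoly m ∪ {v₁, v₂, u₁, u₂} : Finset Pt3) : Set Pt3) := by intro z; simp; tauto
  refine ⟨D1 ∪ D2, ⟨?_, ?_, ?_⟩, by rw [Finset.card_union_of_disjoint hdisj, hc1, hc2]⟩
  · intro σ hσ
    rcases Finset.mem_union.mp hσ with h | h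
    · exact ⟨(x1 σ h).1, (x1 σ h).2.trans hsA⟩
    · exact ⟨(y1 σ h).1, (y1 σ h).2.trans hsB⟩
  · intro σ hσ τ hτ hne
    rcases Finset.mem_union.mp hσ with h | h <;> rcases Finset.mem_union.mp hτ with h' | h'
    · exact x2 σ h τ h' hne
    · rw [Set.inter_comm]; exact hsep τ h' σ h
    · exact hsep σ h τ h'
    · exact y2 σ h τ h' hne
  · rw [Finset.set_biUnion_union, x3, y3]
    apply Set.Subset.antisymm
    · exact Set.union_subset (convexHull_mono hsA) (convexHull_mono hsB)
    · exact conv_split hm hvz hv0 huz hu0 hcross
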